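/- arXiv:math/0306094 — 2 statements merged into one kernel-verified Lean document; each statement's English description precedes it below -/
import Mathlib

section
/- Let E be a finitely generated projective S-module with dual E* = Hom_S(E,S), and let ∇ be a connection on E. Then there exists a unique R-linear map ∇* : E* → Ω[S⁄R] ⊗[S] E* such that for all α ∈ E* and e ∈ E, writing ∇*(α) = Σⱼ ωⱼ ⊗ βⱼ and ∇(e) = Σₖ ηₖ ⊗ fₖ, one has D(α(e)) = Σⱼ βⱼ(e) • ωⱼ + Σₖ α(fₖ) • ηₖ in Ω[S⁄R]; moreover this ∇* is a connection on E*. -/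
open scoped TensorProduct

/-- A connection on an `S`-module `E` (over the base ring `R`). -/
def IsConnection (R S : Type*) [CommRing R] [CommRing S] [Algebra R S]
    {E : Type*} [AddCommGroup E] [Module R E] [Module S E] [IsScalarTower R S E]
    (nabla : E →ₗ[R] KaehlerDifferential R S ⊗[S] E) : Prop :=
  ∀ (s : S) (x : E),
    nabla (s • x) = (KaehlerDifferential.D R S) s ⊗ₜ[S] x + s • nabla x

/-- Contraction `Ω ⊗ E* → Ω`, `ω ⊗ β ↦ β(e) • ω`, for a fixed `e : E`. -/
noncomputable def evDual (R S : Type*) [CommRing R] [CommRing S] [Algebra R S]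
    {E : Type*} [AddCommGroup E] [Module S E] (x : E) :
    KaehlerDifferential R S ⊗[S] (E →ₗ[S] S) →ₗ[S] KaehlerDifferential R S :=
  TensorProduct.lift
    (((LinearMap.lsmul S (KaehlerDifferential R S)).comp (LinearMap.applyₗ x)).flip)

/-- Contraction `Ω ⊗ E → Ω`, `η ⊗ f ↦ α(f) • η`, for a fixed functional `α : E →ₗ[S] S`. -/
noncomputable def evMod (R S : Type*) [CommRing R] [CommRing S] [Algebra R S]
    {E : Type*} [AddCommGroup E] [Module S E] (a : E →ₗ[S] S) :
    KaehlerDifferential R S ⊗[S] E →ₗ[S] KaehlerDifferential R S :=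
  TensorProduct.lift (((LinearMap.lsmul S (KaehlerDifferential R S)).comp a).flip)

section Contraction

variable {R S : Type*} [CommRing R] [CommRing S] [Algebra R S]
  {E : Type*} [AddCommGroup E] [Module S E]

@[simp]
theorem evDual_tmul (x : E) (w : KaehlerDifferential R S) (b : E →ₗ[S] S) :
    evDual R S x (w ⊗ₜ[S] b) = b x • w := by
  simp [evDual]

@[simp]
theorem evMod_tmul (a : E →ₗ[S] S) (w : KaehlerDifferential R S) (x : E) :
    evMod R S a (w ⊗ₜ[S] x) = a x • w := by
  simp [evMod]

theorem evMod_add (a b : E →ₗ[S] S) : evMod R S (a + b) = evMod R S a + evMod R S b := by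
  ext w x
  simp [add_smul]

theorem evMod_smul (s : S) (a : E →ₗ[S] S) : evMod R S (s • a) = s • evMod R S a := by
  ext w x
  simp [mul_smul]

/-- The expansion of a tensor in `Ω ⊗ E*` along a dual basis of `E`. -/
theorem sum_evDual_tmul {ι : Type*} [Fintype ι] {e : ι → E} {α : ι → (E →ₗ[S] S)}
    (hdual : ∀ x : E, ∑ i, α i x • e i = x)
    (t : KaehlerDifferential R S ⊗[S] (E →ₗ[S] S)) :
    ∑ i, evDual R S (e i) t ⊗ₜ[S] α i = t := by
  induction t with
  | zero => simp
  | add t u ht hu =>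
    simp only [map_add, TensorProduct.add_tmul, Finset.sum_add_distrib, ht, hu]
  | tmul w b =>
    have hb : ∑ i, b (e i) • α i = b := by
      ext x
      conv_rhs => rw [← hdual x]
      simp [mul_comm]
    simp only [evDual_tmul, TensorProduct.smul_tmul]
    rw [← TensorProduct.tmul_sum, hb]

/-- Tensors in `Ω ⊗ E*` are separated by the contractions with elements of `E`. -/
theorem evDual_ext {ι : Type*} [Fintype ι] {e : ι → E} {α : ι → (E →ₗ[S] S)}
    (hdual : ∀ x : E, ∑ i, α i x • e i = x)
    {t u : KaehlerDifferential R S ⊗[S] (E →ₗ[S] S)}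
    (htu : ∀ x, evDual R S x t = evDual R S x u) : t = u := by
  rw [← sum_evDual_tmul hdual t, ← sum_evDual_tmul hdual u]
  simp only [htu]

variable [Module R E] [IsScalarTower R S E]

/-- For a connection `∇` and a functional `a`, the `S`-linear map `x ↦ D (a x) - a (∇ x)`. -/
noncomputable def IsConnection.dualForm
    {nabla : E →ₗ[R] KaehlerDifferential R S ⊗[S] E} (h : IsConnection R S nabla)
    (a : E →ₗ[S] S) : E →ₗ[S] KaehlerDifferential R S where
  toFun x := KaehlerDifferential.D R S (a x) - evMod R S a (nabla x)
  map_add' x y := by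
    simp only [map_add]
    abel
  map_smul' s x := by
    simp only [h s x, map_add, map_smul, smul_eq_mul, Derivation.leibniz, evMod_tmul,
      RingHom.id_apply, smul_sub]
    abel

/-- The dual connection of `∇`, written in a dual basis. -/
noncomputable def IsConnection.dual {ι : Type*} [Fintype ι]
    {nabla : E →ₗ[R] KaehlerDifferential R S ⊗[S] E} (h : IsConnection R S nabla)
    (e : ι → E) (α : ι → (E →ₗ[S] S)) :
    (E →ₗ[S] S) →ₗ[R] KaehlerDifferential R S ⊗[S] (E →ₗ[S] S) where
  toFun a := ∑ i, h.dualForm a (e i) ⊗ₜ[S] α i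
  map_add' a b := by
    rw [← Finset.sum_add_distrib]
    refine Finset.sum_congr rfl fun i _ => ?_
    rw [← TensorProduct.add_tmul]
    congr 1
    simp only [dualForm, LinearMap.coe_mk, AddHom.coe_mk, LinearMap.add_apply, map_add, evMod_add]
    abel
  map_smul' r a := by
    rw [RingHom.id_apply, Finset.smul_sum]
    refine Finset.sum_congr rfl fun i _ => ?_
    rw [TensorProduct.smul_tmul']
    congr 1
    have hr : evMod R S (r • a) = algebraMap R S r • evMod R S a := by
      rw [← evMod_smul, algebraMap_smul]
    simp only [dualForm, LinearMap.coe_mk, AddHom.coe_mk, hr, LinearMap.smul_apply,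
      algebraMap_smul, Derivation.map_smul, smul_sub]

theorem IsConnection.evDual_dual {ι : Type*} [Fintype ι]
    {nabla : E →ₗ[R] KaehlerDifferential R S ⊗[S] E} (h : IsConnection R S nabla)
    {e : ι → E} {α : ι → (E →ₗ[S] S)} (hdual : ∀ x : E, ∑ i, α i x • e i = x)
    (a : E →ₗ[S] S) (x : E) :
    evDual R S x (h.dual e α a) = h.dualForm a x := by
  conv_rhs => rw [← hdual x]
  simp [dual]

end Contraction

/-- for `E` finitely generated projective (witnessed by a dual basis) with a
connection `∇`, there is a unique `R`-linear map `∇* : E* → Ω[S⁄R] ⊗[S] E*` such that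
`D(α(e)) = Σⱼ βⱼ(e) • ωⱼ + Σₖ α(fₖ) • ηₖ` whenever `∇*(α) = Σⱼ ωⱼ ⊗ βⱼ` and
`∇(e) = Σₖ ηₖ ⊗ fₖ`; moreover any such `∇*` is a connection on `E*`. -/
theorem stmt7 (R S : Type*) [CommRing R] [CommRing S] [Algebra R S]
    (E : Type*) [AddCommGroup E] [Module R E] [Module S E] [IsScalarTower R S E]
    (n : ℕ) (e : Fin n → E) (α : Fin n → (E →ₗ[S] S))
    (hdual : ∀ x : E, ∑ i, α i x • e i = x)
    (nabla : E →ₗ[R] KaehlerDifferential R S ⊗[S] E)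
    (h : IsConnection R S nabla) :
    (∃! nstar : (E →ₗ[S] S) →ₗ[R] KaehlerDifferential R S ⊗[S] (E →ₗ[S] S),
        ∀ (a : E →ₗ[S] S) (x : E),
          KaehlerDifferential.D R S (a x)
            = evDual R S x (nstar a) + evMod R S a (nabla x)) ∧
      ∀ nstar : (E →ₗ[S] S) →ₗ[R] KaehlerDifferential R S ⊗[S] (E →ₗ[S] S),
        (∀ (a : E →ₗ[S] S) (x : E),
          KaehlerDifferential.D R S (a x)
            = evDual R S x (nstar a) + evMod R S a (nabla x)) →
        IsConnection R S nstar := by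
  refine ⟨⟨h.dual e α, fun a x => ?_, fun nstar hn => ?_⟩, fun nstar hn s a => ?_⟩
  · rw [h.evDual_dual hdual]
    simp [IsConnection.dualForm]
  · ext1 a
    refine evDual_ext hdual fun x => ?_
    rw [h.evDual_dual hdual]
    exact eq_sub_of_add_eq (hn a x).symm
  · refine evDual_ext hdual fun x => ?_
    rw [eq_sub_of_add_eq (hn (s • a) x).symm, map_add, map_smul, evDual_tmul,
      eq_sub_of_add_eq (hn a x).symm, evMod_smul]
    simp only [LinearMap.smul_apply, smul_eq_mul, Derivation.leibniz, smul_sub]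
    abel
end

section
/- Let E and F be normed real vector spaces, Γ : E → (E →L F →L F) a (Christoffel symbol) map, w : ℝ → E → E a time-dependent vector field, and p : ℝ → E a curve with derivative ṗ(t) = w(t)(p(t)) at every t. Let s : ℝ → F solve the parallel transport equation ṡ(t) = −Γ(p(t))(w(t)(p(t)))(s(t)) for all t, and let c : ℝ → E → F be a time-dependent section with c(t)(p(t)) = s(t) for all t, such that the map (t,y) ↦ c(t)(y) is Fréchet differentiable at each point (t, p(t)). Then for every t, the partial time-derivative ∂c/∂t evaluated at (t, p(t)) equals −( D(c(t))(p(t))(w(t)(p(t))) + Γ(p(t))(w(t)(p(t)))(c(t)(p(t))) ), i.e. ċ(t) = −∇_{w(t)} c(t) along the curve, where ∇_v u(y) = Du(y)(v) + Γ(y)(v)(u(y)). -/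
/-- let `E`, `F` be normed real vector spaces, `Γ : E → (E →L F →L F)` a
Christoffel-symbol map, `w : ℝ → E → E` a time-dependent vector field, and `p : ℝ → E` a
curve with `ṗ(t) = w(t)(p(t))`. Let `s : ℝ → F` solve the parallel transport equation
`ṡ(t) = −Γ(p(t))(ṗ(t))(s(t))`, and let `c : ℝ → E → F` be a time-dependent section with
`c(t)(p(t)) = s(t)`, such that `(t,y) ↦ c(t)(y)` is Fréchet differentiable at each point
`(t, p(t))`. Then the partial time-derivative of `c` at `(t, p(t))` equals
`−( D(c(t))(p(t))(w(t)(p(t))) + Γ(p(t))(w(t)(p(t)))(c(t)(p(t))) )`, i.e.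
`ċ(t) = −∇_{w(t)} c(t)` along the curve. -/
theorem stmt15 (E F : Type*) [NormedAddCommGroup E] [NormedSpace ℝ E]
    [NormedAddCommGroup F] [NormedSpace ℝ F]
    (Γ : E → (E →L[ℝ] F →L[ℝ] F))
    (w : ℝ → E → E) (p : ℝ → E)
    (hp : ∀ t : ℝ, HasDerivAt p (w t (p t)) t)
    (s : ℝ → F)
    (hs : ∀ t : ℝ, HasDerivAt s (-(Γ (p t) (w t (p t)) (s t))) t)
    (c : ℝ → E → F)
    (hc : ∀ t : ℝ, c t (p t) = s t)
    (hdiff : ∀ t : ℝ, DifferentiableAt ℝ (fun q : ℝ × E => c q.1 q.2) (t, p t)) :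
    ∀ t : ℝ,
      fderiv ℝ (fun q : ℝ × E => c q.1 q.2) (t, p t) (1, 0)
        = -(fderiv ℝ (c t) (p t) (w t (p t)) + Γ (p t) (w t (p t)) (c t (p t))) := by
  intro t
  have hf := (hdiff t).hasFDerivAt
  set L := fderiv ℝ (fun q : ℝ × E => c q.1 q.2) (t, p t)
  have hspace : HasFDerivAt (c t) (L.comp (ContinuousLinearMap.inr ℝ ℝ E)) (p t) :=
    HasFDerivAt.comp (p t) hf (hasFDerivAt_prodMk_right t (p t))
  have hcurve : HasDerivAt (fun τ => c τ (p τ)) (L (1, w t (p t))) t :=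
    HasFDerivAt.comp_hasDerivAt (f := fun τ => (τ, p τ)) t hf ((hasDerivAt_id t).prodMk (hp t))
  have htransport : L (1, w t (p t)) = -(Γ (p t) (w t (p t)) (s t)) := by
    rw [funext hc] at hcurve
    exact hcurve.unique (hs t)
  have hsplit : L (1, w t (p t)) = L (1, 0) + L (0, w t (p t)) := by
    rw [← map_add]
    simp
  rw [hspace.fderiv, hc t, neg_add_rev, ← htransport, hsplit]
  simp
end
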